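/- arXiv:0710.0222 — 2 statements merged into one kernel-verified Lean document; each statement's English description precedes it below -/
import Mathlib

section
/- For every k ∈ ℕ and δ ∈ ℝ, the generalized contact Hamiltonian X : R^k_δ → R^{k+1}_δ intertwines the sp_{2n+2}-action: for each of the generators A ∈ {X_1, X_{p_i}, X_{q^i}, X_t, X_{p_ip_j}, X_{q^iq^j}, X_{p_jq^i}, X_{tp_i}, X_{tq^i}, X_{t²}} one has L_A ∘ X = X ∘ L_A (L_A acting on R^k_δ on the right-hand side and on R^{k+1}_δ on the left-hand side). Moreover, if k ≥ 1 then X does not commute with the action of all contact vector fields: there exist a smooth function h on ℝ^{2n+1} and S ∈ R^k_δ with L_{X_h}(X(S)) ≠ X(L_{X_h}S); whereas for k = 0, X commutes with L_{X_h} for every smooth h. -/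
open scoped BigOperators

noncomputable section

/-- Points of `ℝ^{2n+1}`. -/
abbrev Vc (n : ℕ) : Type := Fin (2*n+1) → ℝ

/-- Partial derivative of `f : ℝ^ι → ℝ` in the `i`-th coordinate direction. -/
def pd {ι : Type*} [Fintype ι] [DecidableEq ι] (i : ι) (f : (ι → ℝ) → ℝ) (x : ι → ℝ) : ℝ :=
  fderiv ℝ f x (Pi.single i 1)

/-- Index of the coordinate `p_i` in `ℝ^{2n+1}`. -/
def pIdx (n : ℕ) (i : Fin n) : Fin (2*n+1) := ⟨i.1, by have := i.isLt; omega⟩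
/-- Index of the coordinate `q^i` in `ℝ^{2n+1}`. -/
def qIdx (n : ℕ) (i : Fin n) : Fin (2*n+1) := ⟨n + i.1, by have := i.isLt; omega⟩
/-- Index of the coordinate `t` in `ℝ^{2n+1}`. -/
def tIdx (n : ℕ) : Fin (2*n+1) := ⟨2*n, by omega⟩

/-- The contact Hamiltonian vector field `X_h` of a function `h` on `ℝ^{2n+1}`. -/
def contactHam (n : ℕ) (h : Vc n → ℝ) (x : Vc n) : Vc n :=
  fun a =>
    if ha : a.1 < n then
      -pd (qIdx n ⟨a.1, ha⟩) h x - pd (tIdx n) h x * x a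
    else if ha' : a.1 < 2*n then
      pd (pIdx n ⟨a.1 - n, by omega⟩) h x - pd (tIdx n) h x * x a
    else
      (∑ k : Fin n, (x (pIdx n k) * pd (pIdx n k) h x + x (qIdx n k) * pd (qIdx n k) h x))
        - 2 * h x

/-- Base partial derivative `∂_i S` of a symbol `S(x;ξ)`. -/
def pdB (n : ℕ) (i : Fin (2*n+1)) (S : Vc n → Vc n → ℝ) (x ξ : Vc n) : ℝ :=
  fderiv ℝ (fun y => S y ξ) x (Pi.single i 1)

/-- Fiber partial derivative `∂_{ξ_i} S` of a symbol `S(x;ξ)`. -/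
def pdF (n : ℕ) (i : Fin (2*n+1)) (S : Vc n → Vc n → ℝ) (x ξ : Vc n) : ℝ :=
  fderiv ℝ (fun ζ => S x ζ) ξ (Pi.single i 1)

/-- `S` belongs to `R^k_δ`: a smooth map from `ℝ^{2n+1}` into homogeneous polynomials of
degree `k` in the fiber variables `ξ` (the density weight `δ + k/(n+1)` is recorded
through the actions and operators below). -/
def InR (n k : ℕ) (S : Vc n → Vc n → ℝ) : Prop :=
  ContDiff ℝ (⊤ : ℕ∞) (fun p : Vc n × Vc n => S p.1 p.2) ∧
  ∀ (x : Vc n) (c : ℝ) (ξ : Vc n), S x (c • ξ) = c ^ k * S x ξ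

/-- The vertical cotangent lift of the contact form:
`i_α = (1/2)(Σ_j (p_j ∂_{ξ_{q^j}} − q^j ∂_{ξ_{p_j}}) − ∂_{ξ_t})`. -/
def iAlpha (n : ℕ) (S : Vc n → Vc n → ℝ) (x ξ : Vc n) : ℝ :=
  (1/2) * ((∑ j : Fin n, (x (pIdx n j) * pdF n (qIdx n j) S x ξ
      - x (qIdx n j) * pdF n (pIdx n j) S x ξ)) - pdF n (tIdx n) S x ξ)

/-- The generalized contact Hamiltonian with weight constant `a` (equal to
`2(n+1)δ + k` on `R^k_δ`):
`X(S) = Σ_j (ξ_{q^j}∂_{p_j}S − ξ_{p_j}∂_{q^j}S) + ξ_t ℰ_s S − ⟨ℰ_s,ξ_s⟩∂_t S + a ξ_t S`. -/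
def genHam (n : ℕ) (a : ℝ) (S : Vc n → Vc n → ℝ) (x ξ : Vc n) : ℝ :=
  (∑ j : Fin n, (ξ (qIdx n j) * pdB n (pIdx n j) S x ξ
      - ξ (pIdx n j) * pdB n (qIdx n j) S x ξ))
  + ξ (tIdx n) * (∑ j : Fin n, (x (pIdx n j) * pdB n (pIdx n j) S x ξ
      + x (qIdx n j) * pdB n (qIdx n j) S x ξ))
  - (∑ j : Fin n, (x (pIdx n j) * ξ (pIdx n j) + x (qIdx n j) * ξ (qIdx n j)))
      * pdB n (tIdx n) S x ξ
  + a * ξ (tIdx n) * S x ξ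

/-- `ℓ`-fold iteration `X^ℓ` of the generalized Hamiltonian, starting with weight
constant `a` and increasing it by `1` at each step. -/
def genHamPow (n : ℕ) (a : ℝ) : ℕ → (Vc n → Vc n → ℝ) → (Vc n → Vc n → ℝ)
  | 0, S => S
  | ℓ+1, S => genHam n (a + ℓ) (genHamPow n a ℓ S)

/-- The action of a vector field `Xf` on `R^k_δ` with weight `w = δ + k/(n+1)`:
`L_{X}S = X(S) − Σ_{i,j}∂_jX^i ξ_i ∂_{ξ_j}S + w (div X) S`. -/
def LAct (n : ℕ) (w : ℝ) (Xf : Vc n → Vc n) (S : Vc n → Vc n → ℝ) (x ξ : Vc n) : ℝ :=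
  (∑ i, Xf x i * pdB n i S x ξ)
  - (∑ i, ∑ j, pd j (fun y => Xf y i) x * ξ i * pdF n j S x ξ)
  + w * (∑ i, pd i (fun y => Xf y i) x) * S x ξ

/-- Contact Hamiltonians of the generators of `sp_{2n+2}`: the functions
`1, p_i, q^i, t, p_ip_j, q^iq^j, p_jq^i, tp_i, tq^i, t²`. -/
def IsGen (n : ℕ) (h : Vc n → ℝ) : Prop :=
  h = (fun _ => 1) ∨
  (∃ i, h = fun x => x (pIdx n i)) ∨
  (∃ i, h = fun x => x (qIdx n i)) ∨
  h = (fun x => x (tIdx n)) ∨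
  (∃ i j, h = fun x => x (pIdx n i) * x (pIdx n j)) ∨
  (∃ i j, h = fun x => x (qIdx n i) * x (qIdx n j)) ∨
  (∃ i j, h = fun x => x (pIdx n j) * x (qIdx n i)) ∨
  (∃ i, h = fun x => x (tIdx n) * x (pIdx n i)) ∨
  (∃ i, h = fun x => x (tIdx n) * x (qIdx n i)) ∨
  h = (fun x => x (tIdx n) * x (tIdx n))

theorem sum_darboux (n : ℕ) (f : Fin (2*n+1) → ℝ) :
    ∑ i, f i = ∑ j, (f (pIdx n j) + f (qIdx n j)) + f (tIdx n) := by
  rw [Fin.sum_univ_castSucc, ← (finCongr (two_mul n).symm).sum_comp, Fin.sum_univ_add,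
    ← Finset.sum_add_distrib]
  rfl

/-- The linear map `J` with `(Jξ)_{p_j} = ξ_{q^j}`, `(Jξ)_{q^j} = -ξ_{p_j}`, `(Jξ)_t = 0`. -/
def symplMap (n : ℕ) : Vc n →L[ℝ] Vc n :=
  LinearMap.toContinuousLinearMap
    { toFun := fun ξ a =>
        if ha : a.1 < n then ξ (qIdx n ⟨a.1, ha⟩)
        else if ha' : a.1 < 2*n then -ξ (pIdx n ⟨a.1 - n, by omega⟩)
        else 0
      map_add' := fun ξ η => by
        ext a
        simp only [Pi.add_apply]
        split_ifs <;> simp [add_comm]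
      map_smul' := fun c ξ => by
        ext a
        simp only [Pi.smul_apply]
        split_ifs <;> simp }

theorem symplMap_apply (n : ℕ) (ξ : Vc n) (a : Fin (2*n+1)) :
    symplMap n ξ a = if ha : a.1 < n then ξ (qIdx n ⟨a.1, ha⟩)
        else if ha' : a.1 < 2*n then -ξ (pIdx n ⟨a.1 - n, by omega⟩)
        else 0 := rfl

@[simp] theorem symplMap_p (n : ℕ) (ξ : Vc n) (j : Fin n) :
    symplMap n ξ (pIdx n j) = ξ (qIdx n j) := by
  simp [symplMap_apply, pIdx]

@[simp] theorem symplMap_q (n : ℕ) (ξ : Vc n) (j : Fin n) :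
    symplMap n ξ (qIdx n j) = -ξ (pIdx n j) := by
  have := j.isLt
  simp [symplMap_apply, qIdx, show n + j.1 < 2 * n by omega]

@[simp] theorem symplMap_t (n : ℕ) (ξ : Vc n) : symplMap n ξ (tIdx n) = 0 := by
  simp [symplMap_apply, tIdx, show ¬ 2 * n < n by omega]

theorem dotProduct_symplMap (n : ℕ) (ξ η : Vc n) :
    η ⬝ᵥ symplMap n ξ = -(ξ ⬝ᵥ symplMap n η) := by
  simp only [dotProduct, sum_darboux, symplMap_p, symplMap_q, symplMap_t]
  simp only [mul_zero, add_zero, ← Finset.sum_neg_distrib]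
  exact Finset.sum_congr rfl fun j _ => by ring

/-- The coordinate vector `∂_t`. -/
def eT (n : ℕ) : Vc n := Pi.single (tIdx n) 1

@[simp] theorem dotProduct_eT (n : ℕ) (ξ : Vc n) : ξ ⬝ᵥ eT n = ξ (tIdx n) := by
  simp [eT]

/-- The bilinear map `(x, ξ) ↦ ξ_t x - ⟨x, ξ⟩ ∂_t`. -/
def wedgeT (n : ℕ) : Vc n →L[ℝ] Vc n →L[ℝ] Vc n :=
  LinearMap.toContinuousBilinearMap
    (LinearMap.mk₂ ℝ (fun x ξ : Vc n => ξ (tIdx n) • x - (x ⬝ᵥ ξ) • eT n)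
      (fun x y ξ => by simp only [add_dotProduct]; module)
      (fun c x ξ => by simp only [smul_dotProduct, smul_eq_mul]; module)
      (fun x ξ η => by simp only [dotProduct_add, Pi.add_apply]; module)
      (fun c x ξ => by simp only [dotProduct_smul, Pi.smul_apply, smul_eq_mul]; module))

theorem wedgeT_apply (n : ℕ) (x ξ : Vc n) :
    wedgeT n x ξ = ξ (tIdx n) • x - (x ⬝ᵥ ξ) • eT n := rfl

/-- The contraction of the contact bivector at `x` with the covector `ξ`. -/
def contactBiv (n : ℕ) (x ξ : Vc n) : Vc n := symplMap n ξ + wedgeT n x ξ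

theorem contactBiv_sub (n : ℕ) (x ξ η : Vc n) :
    contactBiv n x (ξ - η) = contactBiv n x ξ - contactBiv n x η := by
  simp only [contactBiv, map_sub]; abel

theorem contactBiv_zero (n : ℕ) (x : Vc n) : contactBiv n x 0 = 0 := by
  simp [contactBiv]

theorem contactBiv_neg (n : ℕ) (x ξ : Vc n) :
    contactBiv n x (-ξ) = -contactBiv n x ξ := by
  simp only [contactBiv, map_neg]; abel

theorem contactBiv_smul (n : ℕ) (c : ℝ) (x ξ : Vc n) :
    contactBiv n x (c • ξ) = c • contactBiv n x ξ := by
  simp only [contactBiv, map_smul, smul_add]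

theorem dotProduct_contactBiv (n : ℕ) (x ξ η : Vc n) :
    η ⬝ᵥ contactBiv n x ξ = -(ξ ⬝ᵥ contactBiv n x η) := by
  simp only [contactBiv, wedgeT_apply, dotProduct_add, dotProduct_sub, dotProduct_smul,
    dotProduct_eT, smul_eq_mul, dotProduct_symplMap n ξ η, dotProduct_comm x]
  ring

theorem dotProduct_contactBiv_self (n : ℕ) (x ξ : Vc n) : contactBiv n x ξ ⬝ᵥ ξ = 0 := by
  have := dotProduct_contactBiv n x ξ ξ
  rw [dotProduct_comm]
  linarith

/-- The coordinate vector of a linear form. -/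
def formCoords (n : ℕ) : (Vc n →L[ℝ] ℝ) →L[ℝ] Vc n :=
  ContinuousLinearMap.pi fun i => ContinuousLinearMap.apply ℝ ℝ (Pi.single i (1 : ℝ))

theorem formCoords_apply (n : ℕ) (φ : Vc n →L[ℝ] ℝ) (i : Fin (2*n+1)) :
    formCoords n φ i = φ (Pi.single i 1) := rfl

theorem sum_mul_map_single (n : ℕ) (φ : Vc n →L[ℝ] ℝ) (u : Vc n) :
    ∑ i, u i * φ (Pi.single i 1) = φ u := by
  conv_rhs => rw [pi_eq_sum_univ' u, map_sum]
  simp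

@[simp] theorem formCoords_dotProduct (n : ℕ) (φ : Vc n →L[ℝ] ℝ) (u : Vc n) :
    formCoords n φ ⬝ᵥ u = φ u := by
  rw [dotProduct_comm]
  exact sum_mul_map_single n φ u

@[simp] theorem formCoords_t (n : ℕ) (φ : Vc n →L[ℝ] ℝ) :
    formCoords n φ (tIdx n) = φ (eT n) := rfl

theorem contactHam_eq (n : ℕ) (h : Vc n → ℝ) (D1 : Vc n → Vc n →L[ℝ] ℝ)
    (h1 : ∀ x, HasFDerivAt h (D1 x) x) (x : Vc n) :
    contactHam n h x = -contactBiv n x (formCoords n (D1 x)) - (2 * h x) • eT n := by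
  ext a
  have hp (i) : pd i h x = D1 x (Pi.single i 1) := by rw [pd, (h1 x).fderiv]
  simp only [contactHam, contactBiv, wedgeT_apply, hp]
  have ht : eT n a = if a = tIdx n then 1 else 0 := by simp [eT, Pi.single_apply]
  simp only [Pi.sub_apply, Pi.neg_apply, Pi.add_apply, Pi.smul_apply, smul_eq_mul, symplMap_apply,
    formCoords_apply, ht]
  have hat : a = tIdx n ↔ a.1 = 2 * n := by simp [Fin.ext_iff, tIdx]
  split_ifs with h1 h2 h3 h3 h4
  all_goals first | omega | skip
  · ring
  · ring
  · rw [h4, dotProduct, sum_darboux]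
    simp only [formCoords_apply]
    ring

section Jet

variable {n : ℕ} {h : Vc n → ℝ} {D1 : Vc n → Vc n →L[ℝ] ℝ} {D2 : Vc n → Vc n →L[ℝ] Vc n →L[ℝ] ℝ}

theorem hasFDerivAt_contactHam (h1 : ∀ x, HasFDerivAt h (D1 x) x)
    (h2 : ∀ x, HasFDerivAt D1 (D2 x) x) (x : Vc n) :
    ∃ L : Vc n →L[ℝ] Vc n, HasFDerivAt (contactHam n h) L x ∧ ∀ u, L u =
      -contactBiv n x (formCoords n (D2 x u)) - D1 x (eT n) • u - D1 x u • eT n := by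
  have hg : HasFDerivAt (fun y => formCoords n (D1 y)) ((formCoords n).comp (D2 x)) x :=
    (formCoords n).hasFDerivAt.comp x (h2 x)
  have hX := ((((symplMap n).hasFDerivAt.comp x hg).add
    ((wedgeT n).hasFDerivAt_of_bilinear (hasFDerivAt_id x) hg)).neg).sub
      (((h1 x).const_mul 2).smul_const (eT n))
  refine ⟨_, hX.congr_of_eventuallyEq (Filter.Eventually.of_forall fun y => ?_), fun u => ?_⟩
  · rw [contactHam_eq n h D1 h1 y]; rfl
  · simp [contactBiv, wedgeT_apply, dotProduct_comm u]
    module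

/-- The covector `∂_x⟨ξ, X_h(x)⟩`, in terms of the `2`-jet of `h`. -/
def liftCov (D1 : Vc n → Vc n →L[ℝ] ℝ) (D2 : Vc n → Vc n →L[ℝ] Vc n →L[ℝ] ℝ) (x ξ : Vc n) : Vc n :=
  formCoords n (D2 x (contactBiv n x ξ)) - ξ (tIdx n) • formCoords n (D1 x) - D1 x (eT n) • ξ

theorem pd_contactHam (h1 : ∀ x, HasFDerivAt h (D1 x) x)
    (h2 : ∀ x, HasFDerivAt D1 (D2 x) x) (x : Vc n) (i j : Fin (2*n+1)) :
    pd j (fun y => contactHam n h y i) x =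
      (-contactBiv n x (formCoords n (D2 x (Pi.single j 1))) - D1 x (eT n) • Pi.single j 1
        - D1 x (Pi.single j 1) • eT n : Vc n) i := by
  obtain ⟨L, hL, hLu⟩ := hasFDerivAt_contactHam h1 h2 x
  rw [pd, (hasFDerivAt_pi'.1 hL i).fderiv, ← hLu]
  rfl

theorem sum_pd_contactHam_mul (h1 : ∀ x, HasFDerivAt h (D1 x) x)
    (h2 : ∀ x, HasFDerivAt D1 (D2 x) x) (x ξ : Vc n) (j : Fin (2*n+1)) :
    ∑ i, pd j (fun y => contactHam n h y i) x * ξ i = liftCov D1 D2 x ξ j := by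
  simp only [pd_contactHam h1 h2]
  change (_ - _ - _) ⬝ᵥ ξ = _
  rw [dotProduct_comm]
  simp only [dotProduct_sub, dotProduct_neg, dotProduct_smul, dotProduct_eT]
  rw [dotProduct_contactBiv, formCoords_dotProduct,
    second_derivative_symmetric h1 (h2 x) (Pi.single j 1) (contactBiv n x ξ)]
  simp [liftCov, formCoords_apply]
  ring

theorem div_contactHam (h1 : ∀ x, HasFDerivAt h (D1 x) x)
    (h2 : ∀ x, HasFDerivAt D1 (D2 x) x) (x : Vc n) :
    ∑ i, pd i (fun y => contactHam n h y i) x = -(2 * ((n : ℝ) + 1)) * D1 x (eT n) := by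
  have htr : ∑ i, contactBiv n x (formCoords n (D2 x (Pi.single i 1))) i = 0 := by
    have hterm (i) : contactBiv n x (formCoords n (D2 x (Pi.single i 1))) i
        = -∑ m, contactBiv n x (Pi.single i 1) m * D2 x (Pi.single i 1) (Pi.single m 1) := by
      rw [sum_mul_map_single, ← formCoords_dotProduct, ← dotProduct_contactBiv]
      simp
    have hanti (i m) : contactBiv n x (Pi.single i 1) m = -contactBiv n x (Pi.single m 1) i := by
      simpa using dotProduct_contactBiv n x (Pi.single i 1) (Pi.single m 1)
    have hswap : ∑ i, ∑ m, contactBiv n x (Pi.single i 1) m * D2 x (Pi.single i 1) (Pi.single m 1)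
        = -∑ i, ∑ m,
          contactBiv n x (Pi.single i 1) m * D2 x (Pi.single i 1) (Pi.single m 1) := by
      conv_lhs => rw [Finset.sum_comm]
      simp only [← Finset.sum_neg_distrib]
      refine Finset.sum_congr rfl fun i _ => Finset.sum_congr rfl fun m _ => ?_
      rw [hanti, second_derivative_symmetric h1 (h2 x) (Pi.single m 1)]
      ring
    simp only [hterm, Finset.sum_neg_distrib]
    linarith
  simp only [pd_contactHam h1 h2, Pi.sub_apply, Pi.neg_apply, Finset.sum_sub_distrib,
    Finset.sum_neg_distrib, htr]
  simp [eT, Pi.single_apply]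
  ring

end Jet

section Symbol

variable {n : ℕ} {S : Vc n → Vc n → ℝ} {L : Vc n × Vc n →L[ℝ] ℝ} {x ξ : Vc n}

theorem pdB_eq (hS : HasFDerivAt (fun z : Vc n × Vc n => S z.1 z.2) L (x, ξ))
    (i : Fin (2*n+1)) : pdB n i S x ξ = L.comp (ContinuousLinearMap.inl ℝ _ _) (Pi.single i 1) := by
  have hc : HasFDerivAt (fun y => (y, ξ)) (ContinuousLinearMap.inl ℝ (Vc n) (Vc n)) x :=
    hasFDerivAt_prodMk_left x ξ
  have hf : HasFDerivAt (fun y => S y ξ) (L.comp (ContinuousLinearMap.inl ℝ _ _)) x :=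
    HasFDerivAt.comp (g := fun z : Vc n × Vc n => S z.1 z.2) x hS hc
  rw [pdB, hf.fderiv]

theorem pdF_eq (hS : HasFDerivAt (fun z : Vc n × Vc n => S z.1 z.2) L (x, ξ))
    (i : Fin (2*n+1)) : pdF n i S x ξ = L.comp (ContinuousLinearMap.inr ℝ _ _) (Pi.single i 1) := by
  have hc : HasFDerivAt (fun y => (x, y)) (ContinuousLinearMap.inr ℝ (Vc n) (Vc n)) ξ :=
    hasFDerivAt_prodMk_right x ξ
  have hf : HasFDerivAt (fun y => S x y) (L.comp (ContinuousLinearMap.inr ℝ _ _)) ξ :=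
    HasFDerivAt.comp (g := fun z : Vc n × Vc n => S z.1 z.2) ξ hS hc
  rw [pdF, hf.fderiv]

theorem genHam_eq (hS : HasFDerivAt (fun z : Vc n × Vc n => S z.1 z.2) L (x, ξ)) (a : ℝ) :
    genHam n a S x ξ = L (contactBiv n x ξ, 0) + a * ξ (tIdx n) * S x ξ := by
  have hL : L (contactBiv n x ξ, 0) = ∑ i, contactBiv n x ξ i * pdB n i S x ξ := by
    simp only [pdB_eq hS, sum_mul_map_single]
    simp
  have ht : eT n (tIdx n) = 1 := by simp [eT]
  have hp (j) : eT n (pIdx n j) = 0 := by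
    have := j.isLt
    simp [eT, Pi.single_apply, Fin.ext_iff, tIdx, pIdx]; omega
  have hq (j) : eT n (qIdx n j) = 0 := by
    have := j.isLt
    simp [eT, Pi.single_apply, Fin.ext_iff, tIdx, qIdx]; omega
  rw [hL, genHam, sum_darboux]
  simp only [contactBiv, wedgeT_apply, Pi.add_apply, Pi.sub_apply, Pi.smul_apply, smul_eq_mul,
    symplMap_p, symplMap_q, symplMap_t, ht, hp, hq, dotProduct, sum_darboux, Finset.mul_sum]
  rw [← Finset.sum_add_distrib]
  congr 1
  rw [sub_eq_add_neg]
  congr 1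
  · exact Finset.sum_congr rfl fun j _ => by ring
  · ring

theorem LAct_eq {h : Vc n → ℝ} {D1 : Vc n → Vc n →L[ℝ] ℝ} {D2 : Vc n → Vc n →L[ℝ] Vc n →L[ℝ] ℝ}
    (h1 : ∀ x, HasFDerivAt h (D1 x) x) (h2 : ∀ x, HasFDerivAt D1 (D2 x) x)
    (hS : HasFDerivAt (fun z : Vc n × Vc n => S z.1 z.2) L (x, ξ)) (w : ℝ) :
    LAct n w (contactHam n h) S x ξ = L (contactHam n h x, -liftCov D1 D2 x ξ)
      - 2 * ((n : ℝ) + 1) * w * D1 x (eT n) * S x ξ := by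
  have hB : ∑ i, contactHam n h x i * pdB n i S x ξ = L (contactHam n h x, 0) := by
    simp only [pdB_eq hS, sum_mul_map_single]
    simp
  have hF : ∑ i, ∑ j, pd j (fun y => contactHam n h y i) x * ξ i * pdF n j S x ξ
      = L (0, liftCov D1 D2 x ξ) := by
    rw [Finset.sum_comm]
    simp only [← Finset.sum_mul, sum_pd_contactHam_mul h1 h2, pdF_eq hS, sum_mul_map_single]
    simp
  rw [LAct, hB, hF, div_contactHam h1 h2, ← map_sub]
  simp only [Prod.mk_sub_mk, sub_zero, zero_sub]
  ring

theorem InR.map_fiber {k : ℕ} (hR : InR n k S)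
    (hS : HasFDerivAt (fun z : Vc n × Vc n => S z.1 z.2) L (x, ξ)) :
    L (0, ξ) = k * S x ξ := by
  have hc : HasDerivAt (fun c : ℝ => (x, c • ξ)) ((0 : Vc n), ξ) 1 := by
    simpa using (hasDerivAt_const (1 : ℝ) x).prodMk ((hasDerivAt_id (1 : ℝ)).smul_const ξ)
  have hS' : HasFDerivAt (fun z : Vc n × Vc n => S z.1 z.2) L (x, (1 : ℝ) • ξ) := by simpa using hS
  have hl := hS'.comp_hasDerivAt (1 : ℝ) hc
  have hr := (hasDerivAt_pow k (1 : ℝ)).mul_const (S x ξ)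
  have he : ((fun z : Vc n × Vc n => S z.1 z.2) ∘ fun c : ℝ => (x, c • ξ))
      = fun c => c ^ k * S x ξ := funext fun c => hR.2 x c ξ
  rw [he] at hl
  simpa using hl.unique hr

end Symbol

theorem hasFDerivAt_contactBiv {n : ℕ} (z : Vc n × Vc n) :
    ∃ L : Vc n × Vc n →L[ℝ] Vc n, HasFDerivAt (fun z : Vc n × Vc n => contactBiv n z.1 z.2) L z ∧
      ∀ u, L u = contactBiv n z.1 u.2 + wedgeT n u.1 z.2 := by
  refine ⟨_, ((symplMap n).hasFDerivAt.comp z hasFDerivAt_snd).add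
    ((wedgeT n).hasFDerivAt_of_bilinear hasFDerivAt_fst hasFDerivAt_snd), fun u => ?_⟩
  simp [contactBiv]
  abel

theorem wedgeT_contactBiv {n : ℕ} (x ξ : Vc n) :
    wedgeT n (contactBiv n x ξ) ξ = ξ (tIdx n) • contactBiv n x ξ := by
  simp [wedgeT_apply, dotProduct_contactBiv_self]

theorem hasFDerivAt_liftCov {n : ℕ} {D1 : Vc n → Vc n →L[ℝ] ℝ}
    {D2 : Vc n → Vc n →L[ℝ] Vc n →L[ℝ] ℝ}
    {D3 : Vc n → Vc n →L[ℝ] Vc n →L[ℝ] Vc n →L[ℝ] ℝ}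
    (h2 : ∀ x, HasFDerivAt D1 (D2 x) x) (h3 : ∀ x, HasFDerivAt D2 (D3 x) x) (x ξ : Vc n) :
    ∃ L : Vc n × Vc n →L[ℝ] Vc n,
      HasFDerivAt (fun z : Vc n × Vc n => liftCov D1 D2 z.1 z.2) L (x, ξ) ∧
      L (contactBiv n x ξ, 0) = formCoords n (D3 x (contactBiv n x ξ) (contactBiv n x ξ))
        - D2 x (contactBiv n x ξ) (eT n) • ξ := by
  obtain ⟨V, hV, hVu⟩ := hasFDerivAt_contactBiv (x, ξ)
  have hD1 : HasFDerivAt (fun z : Vc n × Vc n => D1 z.1)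
      ((D2 x).comp (ContinuousLinearMap.fst ℝ _ _)) (x, ξ) :=
    (h2 x).comp (x, ξ) hasFDerivAt_fst
  have hD2 : HasFDerivAt (fun z : Vc n × Vc n => D2 z.1)
      ((D3 x).comp (ContinuousLinearMap.fst ℝ _ _)) (x, ξ) := by
    have hfst : HasFDerivAt Prod.fst (ContinuousLinearMap.fst ℝ (Vc n) (Vc n)) (x, ξ) :=
      hasFDerivAt_fst
    refine HasFDerivAt.comp (g := D2) (g' := D3 x) (x, ξ) ?_ hfst
    exact h3 x
  have ht : HasFDerivAt (fun z : Vc n × Vc n => z.2 (tIdx n))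
      (((ContinuousLinearMap.proj (tIdx n) : Vc n →L[ℝ] ℝ)).comp
        (ContinuousLinearMap.snd ℝ _ _)) (x, ξ) :=
    ((ContinuousLinearMap.proj (tIdx n) : Vc n →L[ℝ] ℝ)).hasFDerivAt.comp (x, ξ) hasFDerivAt_snd
  refine ⟨_, ((((formCoords n).hasFDerivAt.comp (x, ξ) (hD2.clm_apply hV)).sub
    (ht.smul ((formCoords n).hasFDerivAt.comp (x, ξ) hD1))).sub
    ((hD1.clm_apply (hasFDerivAt_const (eT n) _)).smul hasFDerivAt_snd)), ?_⟩
  simp [hVu, wedgeT_contactBiv, contactBiv_zero]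

/-- The defect of equivariance of the generalized contact Hamiltonian under `X_h` is the third
derivative of `h`, contracted with the fiber derivative of the symbol. -/
theorem LAct_genHam_sub {n k : ℕ} {δ : ℝ} {S : Vc n → Vc n → ℝ} (hR : InR n k S)
    {h : Vc n → ℝ} {D1 : Vc n → Vc n →L[ℝ] ℝ}
    {D2 : Vc n → Vc n →L[ℝ] Vc n →L[ℝ] ℝ}
    {D3 : Vc n → Vc n →L[ℝ] Vc n →L[ℝ] Vc n →L[ℝ] ℝ}
    (h1 : ∀ x, HasFDerivAt h (D1 x) x) (h2 : ∀ x, HasFDerivAt D1 (D2 x) x)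
    (h3 : ∀ x, HasFDerivAt D2 (D3 x) x) (x ξ : Vc n) :
    LAct n (δ + ((k : ℝ) + 1)/((n : ℝ) + 1)) (contactHam n h)
          (genHam n (2*((n : ℝ)+1)*δ + k) S) x ξ
        - genHam n (2*((n : ℝ)+1)*δ + k)
            (LAct n (δ + (k : ℝ)/((n : ℝ) + 1)) (contactHam n h) S) x ξ
      = fderiv ℝ (fun z : Vc n × Vc n => S z.1 z.2) (x, ξ)
          (0, formCoords n (D3 x (contactBiv n x ξ) (contactBiv n x ξ))) := by
  set F : Vc n × Vc n → ℝ := fun z => S z.1 z.2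
  have hF1 (z) : HasFDerivAt F (fderiv ℝ F z) z :=
    (hR.1.differentiable (by simp) z).hasFDerivAt
  have hF2 (z) : HasFDerivAt (fderiv ℝ F) (fderiv ℝ (fderiv ℝ F) z) z :=
    ((hR.1.fderiv_right (m := (⊤ : ℕ∞)) (by simp)).differentiable
      (by simp) z).hasFDerivAt
  obtain ⟨V, hV, hVu⟩ := hasFDerivAt_contactBiv (x, ξ)
  obtain ⟨E, hE, hEv⟩ := hasFDerivAt_liftCov h2 h3 x ξ
  obtain ⟨X, hX, hXu⟩ := hasFDerivAt_contactHam h1 h2 x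
  have hD1 : HasFDerivAt (fun z : Vc n × Vc n => D1 z.1)
      ((D2 x).comp (ContinuousLinearMap.fst ℝ _ _)) (x, ξ) :=
    (h2 x).comp (x, ξ) hasFDerivAt_fst
  have ht : HasFDerivAt (fun z : Vc n × Vc n => z.2 (tIdx n))
      (((ContinuousLinearMap.proj (tIdx n) : Vc n →L[ℝ] ℝ)).comp
        (ContinuousLinearMap.snd ℝ _ _)) (x, ξ) :=
    ((ContinuousLinearMap.proj (tIdx n) : Vc n →L[ℝ] ℝ)).hasFDerivAt.comp (x, ξ) hasFDerivAt_snd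
  set a : ℝ := 2*((n : ℝ)+1)*δ + k with ha
  set w : ℝ := δ + (k : ℝ)/((n : ℝ) + 1) with hw
  have hG : HasFDerivAt (fun z : Vc n × Vc n => genHam n a S z.1 z.2) _ (x, ξ) :=
    (((hF2 (x, ξ)).clm_apply (hV.prodMk (hasFDerivAt_const (0 : Vc n) _))).add
      ((ht.const_mul a).mul (hF1 (x, ξ)))).congr_of_eventuallyEq
      (Filter.Eventually.of_forall fun z => genHam_eq (hF1 z) a)
  have hL : HasFDerivAt (fun z : Vc n × Vc n => LAct n w (contactHam n h) S z.1 z.2) _ (x, ξ) :=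
    (((hF2 (x, ξ)).clm_apply ((hX.comp (x, ξ) hasFDerivAt_fst).prodMk hE.neg)).sub
      (((hD1.clm_apply (hasFDerivAt_const (eT n) _)).const_mul
        (2 * ((n : ℝ) + 1) * w)).mul (hF1 (x, ξ)))).congr_of_eventuallyEq
      (Filter.Eventually.of_forall fun z => LAct_eq h1 h2 (hF1 z) w)
  rw [LAct_eq h1 h2 hG, genHam_eq hL, genHam_eq (hF1 (x, ξ)), LAct_eq h1 h2 (hF1 (x, ξ))]
  have hsymm := second_derivative_symmetric hF1 (hF2 (x, ξ)) (contactBiv n x ξ, 0)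
    (contactHam n h x, -liftCov D1 D2 x ξ)
  have hEuler := hR.map_fiber (hF1 (x, ξ))
  have hbracket : V (contactHam n h x, -liftCov D1 D2 x ξ) - X (contactBiv n x ξ)
      = (2 * D1 x (eT n)) • contactBiv n x ξ := by
    have hXξ : contactHam n h x ⬝ᵥ ξ = D1 x (contactBiv n x ξ) - 2 * h x * ξ (tIdx n) := by
      rw [contactHam_eq n h D1 h1, dotProduct_comm]
      simp [dotProduct_contactBiv n x _ ξ]
    rw [hVu, hXu, wedgeT_apply, hXξ]
    simp only [contactHam_eq n h D1 h1, liftCov, contactBiv_neg, contactBiv_sub, contactBiv_smul]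
    module
  have hfib : fderiv ℝ F (x, ξ) (X (contactBiv n x ξ), -E (contactBiv n x ξ, 0))
      = fderiv ℝ F (x, ξ) (V (contactHam n h x, -liftCov D1 D2 x ξ), 0)
        - 2 * D1 x (eT n) * fderiv ℝ F (x, ξ) (contactBiv n x ξ, 0)
        - fderiv ℝ F (x, ξ) (0, formCoords n (D3 x (contactBiv n x ξ) (contactBiv n x ξ)))
        + D2 x (contactBiv n x ξ) (eT n) * (k * S x ξ) := by
    simp only [← hEuler, ← smul_eq_mul (a := 2 * D1 x (eT n)),
      ← smul_eq_mul (a := D2 x (contactBiv n x ξ) (eT n)), ← map_smul, ← map_sub, ← map_add]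
    rw [hEv, ← sub_eq_iff_eq_add'.2 (sub_eq_iff_eq_add.1 hbracket)]
    simp [neg_add_eq_sub]
  have hEt : liftCov D1 D2 x ξ (tIdx n)
      = D2 x (contactBiv n x ξ) (eT n) - 2 * ξ (tIdx n) * D1 x (eT n) := by
    simp [liftCov]
    ring
  have hn : (n : ℝ) + 1 ≠ 0 := by positivity
  have hw1 : 2 * ((n : ℝ) + 1) * w = a + k := by rw [hw, ha]; field_simp; ring
  have hw2 : 2 * ((n : ℝ) + 1) * (δ + ((k : ℝ) + 1) / ((n : ℝ) + 1)) = a + k + 2 := by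
    rw [ha]; field_simp; ring
  have hFS : F (x, ξ) = S x ξ := rfl
  simp only [hw1, hw2]
  simp [hfib, hEt, hFS, hsymm]
  ring

theorem IsGen.eq_quadratic {n : ℕ} {h : Vc n → ℝ} (hh : IsGen n h) :
    ∃ (c : ℝ) (l a b : Vc n →L[ℝ] ℝ), h = fun x => c + l x + a x * b x := by
  let π (i : Fin (2*n+1)) : Vc n →L[ℝ] ℝ := ContinuousLinearMap.proj i
  rcases hh with rfl | ⟨i, rfl⟩ | ⟨i, rfl⟩ | rfl | ⟨i, j, rfl⟩ | ⟨i, j, rfl⟩ | ⟨i, j, rfl⟩ |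
    ⟨i, rfl⟩ | ⟨i, rfl⟩ | rfl
  · exact ⟨1, 0, 0, 0, by simp⟩
  · exact ⟨0, π (pIdx n i), 0, 0, by simp [π]⟩
  · exact ⟨0, π (qIdx n i), 0, 0, by simp [π]⟩
  · exact ⟨0, π (tIdx n), 0, 0, by simp [π]⟩
  · exact ⟨0, 0, π (pIdx n i), π (pIdx n j), by simp [π]⟩
  · exact ⟨0, 0, π (qIdx n i), π (qIdx n j), by simp [π]⟩
  · exact ⟨0, 0, π (pIdx n j), π (qIdx n i), by simp [π]⟩
  · exact ⟨0, 0, π (tIdx n), π (pIdx n i), by simp [π]⟩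
  · exact ⟨0, 0, π (tIdx n), π (qIdx n i), by simp [π]⟩
  · exact ⟨0, 0, π (tIdx n), π (tIdx n), by simp [π]⟩

theorem LAct_genHam_of_quadratic {n k : ℕ} {δ : ℝ} {S : Vc n → Vc n → ℝ} (hR : InR n k S)
    (c : ℝ) (l a b : Vc n →L[ℝ] ℝ) (x ξ : Vc n) :
    LAct n (δ + ((k : ℝ) + 1)/((n : ℝ) + 1)) (contactHam n fun x => c + l x + a x * b x)
          (genHam n (2*((n : ℝ)+1)*δ + k) S) x ξ
        = genHam n (2*((n : ℝ)+1)*δ + k)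
            (LAct n (δ + (k : ℝ)/((n : ℝ) + 1))
              (contactHam n fun x => c + l x + a x * b x) S) x ξ := by
  have h1 (x) : HasFDerivAt (fun x => c + l x + a x * b x) (l + (a x • b + b x • a)) x :=
    (l.hasFDerivAt.const_add c).add (a.hasFDerivAt.mul b.hasFDerivAt)
  have h2 (x) : HasFDerivAt (fun x => l + (a x • b + b x • a)) (a.smulRight b + b.smulRight a) x :=
    ((a.hasFDerivAt.smul_const b).add (b.hasFDerivAt.smul_const a)).const_add l
  rw [← sub_eq_zero, LAct_genHam_sub hR h1 h2 (fun x => hasFDerivAt_const _ x)]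
  simp only [_root_.zero_apply, map_zero]
  exact map_zero _

theorem LAct_genHam_cube_ne {n k : ℕ} (hk : 1 ≤ k) (i : Fin n) (δ : ℝ) :
    LAct n (δ + ((k : ℝ) + 1)/((n : ℝ) + 1)) (contactHam n fun x => x (pIdx n i) ^ 3)
          (genHam n (2*((n : ℝ)+1)*δ + k) fun _ ξ => ξ (pIdx n i) ^ k) 0 1
        ≠ genHam n (2*((n : ℝ)+1)*δ + k)
            (LAct n (δ + (k : ℝ)/((n : ℝ) + 1)) (contactHam n fun x => x (pIdx n i) ^ 3)
              fun _ ξ => ξ (pIdx n i) ^ k) 0 1 := by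
  have hR : InR n k fun _ ξ => ξ (pIdx n i) ^ k :=
    ⟨by fun_prop, fun x c ξ => by simp [mul_pow]⟩
  let a : Vc n →L[ℝ] ℝ := ContinuousLinearMap.proj (pIdx n i)
  have h1 (x : Vc n) : HasFDerivAt (fun x : Vc n => x (pIdx n i) ^ 3) ((3 * a x ^ 2) • a) x := by
    refine (a.hasFDerivAt.pow 3).congr_fderiv ?_
    simp
  have h2 (x : Vc n) : HasFDerivAt (fun x => (3 * a x ^ 2) • a) ((6 * a x) • a.smulRight a) x := by
    refine (((a.hasFDerivAt.pow 2).const_mul 3).smul_const a).congr_fderiv ?_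
    ext u v
    simp
    ring
  have h3 (x : Vc n) : HasFDerivAt (fun x => (6 * a x) • a.smulRight a)
      (((6 : ℝ) • a).smulRight (a.smulRight a)) x :=
    ContinuousLinearMap.hasFDerivAt (𝕜 := ℝ) (E := Vc n) (F := Vc n →L[ℝ] Vc n →L[ℝ] ℝ)
      (((6 : ℝ) • a).smulRight (a.smulRight a))
  rw [← sub_ne_zero, LAct_genHam_sub hR h1 h2 h3]
  have hF := ((a.comp (ContinuousLinearMap.snd ℝ (Vc n) (Vc n))).hasFDerivAt (x := (0, 1))).pow k
  change fderiv ℝ (fun z => a.comp (ContinuousLinearMap.snd ℝ (Vc n) (Vc n)) z ^ k) _ _ ≠ 0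
  rw [hF.fderiv]
  have hv : a (contactBiv n 0 1) = 1 := by simp [a, contactBiv]
  have ha : a 1 = 1 := rfl
  have hp : a (formCoords n a) = 1 := by simp [a, formCoords_apply]
  simp [hv, hp, ha]
  omega

theorem LAct_genHam_of_degree_zero {n : ℕ} {δ : ℝ} {h : Vc n → ℝ} (hh : ContDiff ℝ (⊤ : ℕ∞) h)
    {S : Vc n → Vc n → ℝ} (hR : InR n 0 S) (x ξ : Vc n) :
    LAct n (δ + 1/((n : ℝ) + 1)) (contactHam n h) (genHam n (2*((n : ℝ)+1)*δ) S) x ξ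
      = genHam n (2*((n : ℝ)+1)*δ) (LAct n δ (contactHam n h) S) x ξ := by
  have hd1 : ContDiff ℝ (⊤ : ℕ∞) (fderiv ℝ h) := hh.fderiv_right (by simp)
  have hd2 : ContDiff ℝ (⊤ : ℕ∞) (fderiv ℝ (fderiv ℝ h)) := hd1.fderiv_right (by simp)
  have hS : HasFDerivAt (fun z : Vc n × Vc n => S z.1 z.2) _ (x, ξ) :=
    (hR.1.differentiable (by simp) _).hasFDerivAt
  have hfiber (η : Vc n) : fderiv ℝ (fun z : Vc n × Vc n => S z.1 z.2) (x, ξ) (0, η) = 0 := by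
    have hconst : (fun ζ => S x ζ) = fun _ => S x 0 := funext fun ζ => by
      rw [← zero_smul ℝ ζ, hR.2 x 0 ζ, pow_zero, one_mul]
    have hpd (i) : pdF n i S x ξ = 0 := by rw [pdF, hconst]; simp
    have := sum_mul_map_single n ((fderiv ℝ (fun z : Vc n × Vc n => S z.1 z.2) (x, ξ)).comp
      (ContinuousLinearMap.inr ℝ _ _)) η
    simp only [← pdF_eq hS, hpd, mul_zero, Finset.sum_const_zero] at this
    exact this.symm
  have := LAct_genHam_sub (δ := δ) hR
    (fun x => (hh.differentiable (by simp) x).hasFDerivAt)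
    (fun x => (hd1.differentiable (by simp) x).hasFDerivAt)
    (fun x => (hd2.differentiable (by simp) x).hasFDerivAt) x ξ
  rw [hfiber, sub_eq_zero] at this
  simpa using this

/-- `X : R^k_δ → R^{k+1}_δ` intertwines the `sp_{2n+2}`-action; it does not commute with
the full `CVect(ℝ^{2n+1})`-action unless `k = 0`. -/
theorem stmt7 (n : ℕ) (hn : 1 ≤ n) (k : ℕ) (δ : ℝ) :
    (∀ S, InR n k S → ∀ h, IsGen n h → ∀ x ξ,
      LAct n (δ + ((k : ℝ) + 1)/((n : ℝ) + 1)) (contactHam n h)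
          (genHam n (2*((n : ℝ)+1)*δ + k) S) x ξ
        = genHam n (2*((n : ℝ)+1)*δ + k)
            (LAct n (δ + (k : ℝ)/((n : ℝ) + 1)) (contactHam n h) S) x ξ) ∧
    (1 ≤ k → ∃ h : Vc n → ℝ, ContDiff ℝ (⊤ : ℕ∞) h ∧ ∃ S, InR n k S ∧ ∃ x ξ,
      LAct n (δ + ((k : ℝ) + 1)/((n : ℝ) + 1)) (contactHam n h)
          (genHam n (2*((n : ℝ)+1)*δ + k) S) x ξ
        ≠ genHam n (2*((n : ℝ)+1)*δ + k)
            (LAct n (δ + (k : ℝ)/((n : ℝ) + 1)) (contactHam n h) S) x ξ) ∧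
    (k = 0 → ∀ h : Vc n → ℝ, ContDiff ℝ (⊤ : ℕ∞) h → ∀ S, InR n 0 S → ∀ x ξ,
      LAct n (δ + 1/((n : ℝ) + 1)) (contactHam n h) (genHam n (2*((n : ℝ)+1)*δ) S) x ξ
        = genHam n (2*((n : ℝ)+1)*δ)
            (LAct n δ (contactHam n h) S) x ξ) := by
  refine ⟨fun S hS h hh x ξ => ?_, fun hk => ?_, ?_⟩
  · obtain ⟨c, l, a, b, rfl⟩ := hh.eq_quadratic
    exact LAct_genHam_of_quadratic hS c l a b x ξ
  · exact ⟨_, by fun_prop, _, ⟨by fun_prop, fun x c ξ => by simp [mul_pow]⟩, 0, 1,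
      LAct_genHam_cube_ne hk ⟨0, hn⟩ δ⟩
  · rintro rfl h hh S hS x ξ
    exact LAct_genHam_of_degree_zero hh hS x ξ
end
end

section
/- For every k ∈ ℕ, δ ∈ ℝ and every integer ℓ ≥ 1, the following operator identity holds on R^k_δ: i_α ∘ X^ℓ = X^ℓ ∘ i_α + r(ℓ,k)·X^{ℓ−1}, where r(ℓ,k) = −(ℓ/2)(2(n+1)δ + 2k + ℓ − 1). -/
open scoped BigOperators

noncomputable section

/-- The vector of `ℝ^{2n+1}` with `p`-components `u`, `q`-components `v` and `t`-component `w`. -/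
def coordVec (n : ℕ) (u v : Fin n → ℝ) (w : ℝ) : Vc n :=
  ∑ j : Fin n, (u j • Pi.single (pIdx n j) (1 : ℝ) + v j • Pi.single (qIdx n j) (1 : ℝ))
    + w • Pi.single (tIdx n) (1 : ℝ)

lemma pIdx_inj {n : ℕ} {i j : Fin n} : pIdx n i = pIdx n j ↔ i = j := by
  simp [pIdx, Fin.ext_iff]

lemma qIdx_inj {n : ℕ} {i j : Fin n} : qIdx n i = qIdx n j ↔ i = j := by
  simp [qIdx, Fin.ext_iff]

lemma pIdx_ne_qIdx {n : ℕ} (i j : Fin n) : pIdx n i ≠ qIdx n j := by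
  simp only [pIdx, qIdx, ne_eq, Fin.ext_iff]; omega

lemma pIdx_ne_tIdx {n : ℕ} (i : Fin n) : pIdx n i ≠ tIdx n := by
  simp only [pIdx, tIdx, ne_eq, Fin.ext_iff]; omega

lemma qIdx_ne_tIdx {n : ℕ} (i : Fin n) : qIdx n i ≠ tIdx n := by
  simp only [qIdx, tIdx, ne_eq, Fin.ext_iff]; omega

@[simp] lemma coordVec_pIdx (n : ℕ) (u v : Fin n → ℝ) (w : ℝ) (i : Fin n) :
    coordVec n u v w (pIdx n i) = u i := by
  simp [coordVec, Pi.single_apply, pIdx_inj, pIdx_ne_qIdx, pIdx_ne_tIdx]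

@[simp] lemma coordVec_qIdx (n : ℕ) (u v : Fin n → ℝ) (w : ℝ) (i : Fin n) :
    coordVec n u v w (qIdx n i) = v i := by
  simp [coordVec, Pi.single_apply, qIdx_inj, (pIdx_ne_qIdx _ _).symm, qIdx_ne_tIdx]

@[simp] lemma coordVec_tIdx (n : ℕ) (u v : Fin n → ℝ) (w : ℝ) :
    coordVec n u v w (tIdx n) = w := by
  simp [coordVec, (pIdx_ne_tIdx _).symm, (qIdx_ne_tIdx _).symm]

lemma vc_ext {n : ℕ} {x y : Vc n} (hp : ∀ i, x (pIdx n i) = y (pIdx n i))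
    (hq : ∀ i, x (qIdx n i) = y (qIdx n i)) (ht : x (tIdx n) = y (tIdx n)) : x = y := by
  ext a
  by_cases h₁ : a.1 < n
  · exact hp ⟨a.1, h₁⟩
  by_cases h₂ : a.1 < 2 * n
  · have : a = qIdx n ⟨a.1 - n, by omega⟩ := by
      simp only [qIdx, Fin.ext_iff]; omega
    rw [this]
    exact hq _
  · have : a = tIdx n := by
      simp only [tIdx, Fin.ext_iff]; omega
    rw [this]
    exact ht

/-- The base component of the first-order part of the generalized contact Hamiltonian. -/
def hamField (n : ℕ) (z : Vc n × Vc n) : Vc n :=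
  coordVec n (fun j => z.2 (qIdx n j) + z.2 (tIdx n) * z.1 (pIdx n j))
    (fun j => -z.2 (pIdx n j) + z.2 (tIdx n) * z.1 (qIdx n j))
    (-∑ j : Fin n, (z.1 (pIdx n j) * z.2 (pIdx n j) + z.1 (qIdx n j) * z.2 (qIdx n j)))

/-- The fiber component of the vertical vector field `i_α`. -/
def alphaField (n : ℕ) (x : Vc n) : Vc n :=
  coordVec n (fun j => -(1 / 2) * x (qIdx n j)) (fun j => 1 / 2 * x (pIdx n j)) (-(1 / 2))

lemma contDiff_hamField (n : ℕ) : ContDiff ℝ (⊤ : ℕ∞) (hamField n) := by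
  unfold hamField coordVec
  fun_prop

lemma contDiff_alphaField (n : ℕ) : ContDiff ℝ (⊤ : ℕ∞) (alphaField n) := by
  unfold alphaField coordVec
  fun_prop

/-- `hamField` is invariant under the flow of `alphaField`. -/
lemma hamField_add_smul_alphaField (n : ℕ) (x ξ : Vc n) (s : ℝ) :
    hamField n (x, ξ + s • alphaField n x) = hamField n (x, ξ) := by
  refine vc_ext (fun i => ?_) (fun i => ?_) ?_
  · simp [hamField, alphaField]; ring
  · simp [hamField, alphaField]; ring
  · simp only [hamField, alphaField, coordVec_tIdx, Pi.add_apply, Pi.smul_apply, smul_eq_mul,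
      coordVec_pIdx, coordVec_qIdx]
    congr 1
    exact Finset.sum_congr rfl fun i _ => by ring

lemma alphaField_add_smul_hamField (n : ℕ) (x ξ : Vc n) (s : ℝ) :
    alphaField n (x + s • hamField n (x, ξ))
      = alphaField n x + s • ((1 / 2 : ℝ) • ξ + ξ (tIdx n) • alphaField n x) := by
  refine vc_ext (fun i => ?_) (fun i => ?_) ?_
  · simp [hamField, alphaField]; ring
  · simp [hamField, alphaField]; ring
  · simp [alphaField]; ring

lemma fderiv_hamField (n : ℕ) (x ξ : Vc n) :
    fderiv ℝ (hamField n) (x, ξ) (0, alphaField n x) = 0 := by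
  rw [← (((contDiff_hamField n).differentiable (by simp)) _).lineDeriv_eq_fderiv, lineDeriv]
  simp [hamField_add_smul_alphaField]

lemma fderiv_alphaField (n : ℕ) (x ξ : Vc n) :
    fderiv ℝ (alphaField n) x (hamField n (x, ξ))
      = (1 / 2 : ℝ) • ξ + ξ (tIdx n) • alphaField n x := by
  rw [← (((contDiff_alphaField n).differentiable (by simp)) _).lineDeriv_eq_fderiv, lineDeriv]
  simp only [alphaField_add_smul_hamField]
  simpa using (((hasDerivAt_id (0 : ℝ)).smul_const
    ((1 / 2 : ℝ) • ξ + ξ (tIdx n) • alphaField n x)).const_add (alphaField n x)).deriv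

lemma pdB_eq_fderiv {n : ℕ} {S : Vc n → Vc n → ℝ} {x ξ : Vc n}
    (hS : DifferentiableAt ℝ (fun p : Vc n × Vc n => S p.1 p.2) (x, ξ)) (i : Fin (2 * n + 1)) :
    pdB n i S x ξ
      = fderiv ℝ (fun p : Vc n × Vc n => S p.1 p.2) (x, ξ) (Pi.single i 1, 0) := by
  have h := (hS.hasFDerivAt.comp (f := fun y => (y, ξ)) x ((hasFDerivAt_id x).prodMk (hasFDerivAt_const ξ x))).fderiv
  exact congrArg (fun L : Vc n →L[ℝ] ℝ => L (Pi.single i 1)) h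

lemma pdF_eq_fderiv {n : ℕ} {S : Vc n → Vc n → ℝ} {x ξ : Vc n}
    (hS : DifferentiableAt ℝ (fun p : Vc n × Vc n => S p.1 p.2) (x, ξ)) (i : Fin (2 * n + 1)) :
    pdF n i S x ξ
      = fderiv ℝ (fun p : Vc n × Vc n => S p.1 p.2) (x, ξ) (0, Pi.single i 1) := by
  have h := (hS.hasFDerivAt.comp (f := fun ζ => (x, ζ)) ξ
    ((hasFDerivAt_const x ξ).prodMk (hasFDerivAt_id ξ))).fderiv
  exact congrArg (fun L : Vc n →L[ℝ] ℝ => L (Pi.single i 1)) h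

lemma map_coordVec {n : ℕ} (L : Vc n →L[ℝ] ℝ) (u v : Fin n → ℝ) (w : ℝ) :
    L (coordVec n u v w) = ∑ j, (u j * L (Pi.single (pIdx n j) 1)
      + v j * L (Pi.single (qIdx n j) 1)) + w * L (Pi.single (tIdx n) 1) := by
  simp [coordVec]

lemma genHam_eq_fderiv {n : ℕ} (a : ℝ) {S : Vc n → Vc n → ℝ} {x ξ : Vc n}
    (hS : DifferentiableAt ℝ (fun p : Vc n × Vc n => S p.1 p.2) (x, ξ)) :
    genHam n a S x ξ
      = fderiv ℝ (fun p : Vc n × Vc n => S p.1 p.2) (x, ξ) (hamField n (x, ξ), 0)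
        + a * ξ (tIdx n) * S x ξ := by
  have h := map_coordVec ((fderiv ℝ (fun p : Vc n × Vc n => S p.1 p.2) (x, ξ)).comp
    (ContinuousLinearMap.inl ℝ (Vc n) (Vc n)))
  simp only [ContinuousLinearMap.comp_apply, ContinuousLinearMap.inl_apply] at h
  rw [hamField, h]
  simp only [genHam, pdB_eq_fderiv hS, Finset.mul_sum, neg_mul, ← sub_eq_add_neg,
    ← Finset.sum_add_distrib]
  congr 2
  exact Finset.sum_congr rfl fun i _ => by ring

lemma iAlpha_eq_fderiv {n : ℕ} {S : Vc n → Vc n → ℝ} {x ξ : Vc n}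
    (hS : DifferentiableAt ℝ (fun p : Vc n × Vc n => S p.1 p.2) (x, ξ)) :
    iAlpha n S x ξ
      = fderiv ℝ (fun p : Vc n × Vc n => S p.1 p.2) (x, ξ) (0, alphaField n x) := by
  have h := map_coordVec ((fderiv ℝ (fun p : Vc n × Vc n => S p.1 p.2) (x, ξ)).comp
    (ContinuousLinearMap.inr ℝ (Vc n) (Vc n)))
  simp only [ContinuousLinearMap.comp_apply, ContinuousLinearMap.inr_apply] at h
  rw [alphaField, h]
  simp only [iAlpha, pdF_eq_fderiv hS, mul_sub, Finset.mul_sum, neg_mul, ← sub_eq_add_neg]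
  congr 1
  exact Finset.sum_congr rfl fun i _ => by ring

section Smooth

variable {n : ℕ} {S : Vc n → Vc n → ℝ}

lemma genHam_eq_of_contDiff (hS : ContDiff ℝ (⊤ : ℕ∞) (fun p : Vc n × Vc n => S p.1 p.2))
    (a : ℝ) : (fun p : Vc n × Vc n => genHam n a S p.1 p.2) = fun p =>
      fderiv ℝ (fun p : Vc n × Vc n => S p.1 p.2) p (hamField n p, 0)
        + a * p.2 (tIdx n) * S p.1 p.2 :=
  funext fun p => genHam_eq_fderiv a (hS.differentiable (by simp) p)

lemma iAlpha_eq_of_contDiff (hS : ContDiff ℝ (⊤ : ℕ∞) (fun p : Vc n × Vc n => S p.1 p.2)) :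
    (fun p : Vc n × Vc n => iAlpha n S p.1 p.2) = fun p =>
      fderiv ℝ (fun p : Vc n × Vc n => S p.1 p.2) p (0, alphaField n p.1) :=
  funext fun p => iAlpha_eq_fderiv (hS.differentiable (by simp) p)

lemma contDiff_genHam (hS : ContDiff ℝ (⊤ : ℕ∞) (fun p : Vc n × Vc n => S p.1 p.2)) (a : ℝ) :
    ContDiff ℝ (⊤ : ℕ∞) (fun p : Vc n × Vc n => genHam n a S p.1 p.2) := by
  rw [genHam_eq_of_contDiff hS]
  have h₁ : ContDiff ℝ (⊤ : ℕ∞) (fderiv ℝ (fun p : Vc n × Vc n => S p.1 p.2)) :=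
    hS.fderiv_right (by simp)
  have h₂ := contDiff_hamField n
  exact (h₁.clm_apply (h₂.prodMk contDiff_const)).add
    (ContDiff.mul (by fun_prop) hS)

lemma contDiff_iAlpha (hS : ContDiff ℝ (⊤ : ℕ∞) (fun p : Vc n × Vc n => S p.1 p.2)) :
    ContDiff ℝ (⊤ : ℕ∞) (fun p : Vc n × Vc n => iAlpha n S p.1 p.2) := by
  rw [iAlpha_eq_of_contDiff hS]
  have h₁ : ContDiff ℝ (⊤ : ℕ∞) (fderiv ℝ (fun p : Vc n × Vc n => S p.1 p.2)) :=
    hS.fderiv_right (by simp)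
  exact h₁.clm_apply (contDiff_const.prodMk ((contDiff_alphaField n).comp contDiff_fst))

lemma contDiff_genHamPow (hS : ContDiff ℝ (⊤ : ℕ∞) (fun p : Vc n × Vc n => S p.1 p.2))
    (a : ℝ) (ℓ : ℕ) :
    ContDiff ℝ (⊤ : ℕ∞) (fun p : Vc n × Vc n => genHamPow n a ℓ S p.1 p.2) := by
  induction ℓ with
  | zero => exact hS
  | succ ℓ ih => exact contDiff_genHam ih _

end Smooth

lemma InR.genHam {n k : ℕ} {S : Vc n → Vc n → ℝ} (hS : InR n k S) (a : ℝ) :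
    InR n (k + 1) (genHam n a S) := by
  refine ⟨contDiff_genHam hS.1 a, fun x c ξ => ?_⟩
  have hpd (i) : pdB n i S x (c • ξ) = c ^ k * pdB n i S x ξ := by
    have hd : DifferentiableAt ℝ (fun y => S y ξ) x :=
      ((hS.1.comp (contDiff_id.prodMk (contDiff_const (c := ξ)))).differentiable (by simp)) x
    simp only [pdB, hS.2, fderiv_const_mul hd]
    simp
  simp only [_root_.genHam, hpd, hS.2, Pi.smul_apply, smul_eq_mul, Finset.mul_sum, Finset.sum_mul,
    mul_add, mul_sub, pow_succ]
  congr 1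
  · congr 1
    · congr 1 <;> exact Finset.sum_congr rfl fun i _ => by ring
    · exact Finset.sum_congr rfl fun i _ => by ring
  · ring

lemma InR.genHamPow {n k : ℕ} {S : Vc n → Vc n → ℝ} (hS : InR n k S) (a : ℝ) (ℓ : ℕ) :
    InR n (k + ℓ) (genHamPow n a ℓ S) := by
  induction ℓ with
  | zero => exact hS
  | succ ℓ ih => exact ih.genHam _

/-- Euler's identity in the fiber variables. -/
lemma InR.fderiv_euler {n k : ℕ} {S : Vc n → Vc n → ℝ} (hS : InR n k S) (x ξ : Vc n) :
    fderiv ℝ (fun p : Vc n × Vc n => S p.1 p.2) (x, ξ) (0, ξ) = k * S x ξ := by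
  rw [← ((hS.1.differentiable (by simp)) _).lineDeriv_eq_fderiv, lineDeriv]
  have h (s : ℝ) : ξ + s • ξ = (1 + s) • ξ := by rw [add_smul, one_smul]
  simp only [Prod.smul_mk, Prod.mk_add_mk, smul_zero, add_zero, h, hS.2]
  simpa using ((((hasDerivAt_id (0 : ℝ)).const_add 1).pow k).mul_const (S x ξ)).deriv

lemma fderiv_fderiv_apply {E : Type*} [NormedAddCommGroup E] [NormedSpace ℝ E]
    {F : E → ℝ} (hF : ContDiff ℝ (⊤ : ℕ∞) F) {W : E → E} {z : E}
    (hW : DifferentiableAt ℝ W z) (v : E) :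
    fderiv ℝ (fun y => fderiv ℝ F y (W y)) z v
      = fderiv ℝ (fderiv ℝ F) z v (W z) + fderiv ℝ F z (fderiv ℝ W z v) := by
  have h₁ : ContDiff ℝ (⊤ : ℕ∞) (fderiv ℝ F) := hF.fderiv_right (by simp)
  rw [fderiv_clm_apply (h₁.differentiable (by simp) z) hW]
  simp [add_comm]

lemma InR.iAlpha_genHam {n k : ℕ} {S : Vc n → Vc n → ℝ} (hS : InR n k S) (a : ℝ) (x ξ : Vc n) :
    iAlpha n (_root_.genHam n a S) x ξ
      = _root_.genHam n (a - 1) (iAlpha n S) x ξ - (a + k) / 2 * S x ξ := by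
  have hd := hS.1.differentiable (by simp)
  have hA : DifferentiableAt ℝ (hamField n) (x, ξ) :=
    (contDiff_hamField n).differentiable (by simp) _
  have hB : DifferentiableAt ℝ (alphaField n) x :=
    (contDiff_alphaField n).differentiable (by simp) _
  have hB' : HasFDerivAt (fun p : Vc n × Vc n => alphaField n p.1)
      ((fderiv ℝ (alphaField n) x).comp (ContinuousLinearMap.fst ℝ (Vc n) (Vc n))) (x, ξ) :=
    HasFDerivAt.comp (g := alphaField n) (f := Prod.fst) (x, ξ) hB.hasFDerivAt hasFDerivAt_fst
  have hA₀ : HasFDerivAt (fun p : Vc n × Vc n => (hamField n p, (0 : Vc n))) _ (x, ξ) :=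
    hA.hasFDerivAt.prodMk (hasFDerivAt_const 0 _)
  have hB₀ : HasFDerivAt (fun p : Vc n × Vc n => ((0 : Vc n), alphaField n p.1)) _ (x, ξ) :=
    (hasFDerivAt_const 0 _).prodMk hB'
  have h₁ : ContDiff ℝ (⊤ : ℕ∞) (fderiv ℝ (fun p : Vc n × Vc n => S p.1 p.2)) :=
    hS.1.fderiv_right (by simp)
  have ht : HasFDerivAt (fun p : Vc n × Vc n => a * p.2 (tIdx n))
      (a • (ContinuousLinearMap.proj (R := ℝ) (φ := fun _ => ℝ) (tIdx n)).comp
        (ContinuousLinearMap.snd ℝ (Vc n) (Vc n))) (x, ξ) :=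
    (((ContinuousLinearMap.proj (R := ℝ) (φ := fun _ => ℝ) (tIdx n)).comp
        (ContinuousLinearMap.snd ℝ (Vc n) (Vc n))).hasFDerivAt).const_mul a
  have hsymm : IsSymmSndFDerivAt ℝ (fun p : Vc n × Vc n => S p.1 p.2) (x, ξ) :=
    hS.1.contDiffAt.isSymmSndFDerivAt (by
      rw [minSmoothness_of_isRCLikeNormedField]
      exact WithTop.coe_le_coe.2 (le_top : (2 : ℕ∞) ≤ ⊤))
  rw [iAlpha_eq_fderiv ((contDiff_genHam hS.1 a).differentiable (by simp) _),
    genHam_eq_fderiv _ ((contDiff_iAlpha hS.1).differentiable (by simp) _),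
    genHam_eq_of_contDiff hS.1, iAlpha_eq_of_contDiff hS.1,
    fderiv_fun_add ((h₁.differentiable (by simp) _).clm_apply hA₀.differentiableAt)
      (ht.differentiableAt.fun_mul (hd _)),
    add_apply, fderiv_fderiv_apply hS.1 hA₀.differentiableAt,
    fderiv_fderiv_apply hS.1 hB₀.differentiableAt, hA₀.fderiv, hB₀.fderiv,
    fderiv_fun_mul ht.differentiableAt (hd _), ht.fderiv, iAlpha_eq_fderiv (hd _),
    hsymm.eq (hamField n (x, ξ), 0)]
  have hsplit : ((0 : Vc n), (1 / 2 : ℝ) • ξ + ξ (tIdx n) • alphaField n x)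
      = (1 / 2 : ℝ) • ((0 : Vc n), ξ) + ξ (tIdx n) • ((0 : Vc n), alphaField n x) := by
    simp
  have ht' : alphaField n x (tIdx n) = -(1 / 2) := by simp [alphaField]
  simp only [ContinuousLinearMap.prod_apply, ContinuousLinearMap.comp_apply,
    ContinuousLinearMap.coe_fst', zero_apply, fderiv_hamField,
    fderiv_alphaField, hsplit, map_add, map_smul, hS.fderiv_euler, add_apply,
    smul_apply, ContinuousLinearMap.coe_snd', ContinuousLinearMap.proj_apply,
    smul_eq_mul, ht', Prod.mk_zero_zero, map_zero]
  ring

lemma genHam_add_const_mul {n : ℕ} (a r : ℝ) {S T : Vc n → Vc n → ℝ} {x ξ : Vc n}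
    (hS : DifferentiableAt ℝ (fun p : Vc n × Vc n => S p.1 p.2) (x, ξ))
    (hT : DifferentiableAt ℝ (fun p : Vc n × Vc n => T p.1 p.2) (x, ξ)) :
    genHam n a (fun y ζ => S y ζ + r * T y ζ) x ξ
      = genHam n a S x ξ + r * genHam n a T x ξ := by
  rw [genHam_eq_fderiv a (hS.add (hT.const_mul r)), genHam_eq_fderiv a hS, genHam_eq_fderiv a hT,
    fderiv_fun_add hS (hT.const_mul r), fderiv_const_mul hT]
  simp only [add_apply, smul_apply, smul_eq_mul]
  ring

lemma InR.iAlpha_genHamPow_succ {n k : ℕ} {S : Vc n → Vc n → ℝ} (hS : InR n k S) (a : ℝ)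
    (ℓ : ℕ) (x ξ : Vc n) :
    iAlpha n (_root_.genHamPow n a (ℓ + 1) S) x ξ
      = _root_.genHamPow n (a - 1) (ℓ + 1) (iAlpha n S) x ξ
        + (-((ℓ + 1 : ℝ) / 2) * (a + k + ℓ)) * _root_.genHamPow n a ℓ S x ξ := by
  induction ℓ generalizing x ξ with
  | zero =>
    simp only [_root_.genHamPow, hS.iAlpha_genHam, Nat.cast_zero, add_zero]
    ring
  | succ ℓ ih =>
    rw [_root_.genHamPow, (hS.genHamPow a (ℓ + 1)).iAlpha_genHam, funext₂ ih,
      genHam_add_const_mul _ _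
        ((contDiff_genHamPow (contDiff_iAlpha hS.1) _ _).differentiable (by simp) _)
        ((contDiff_genHamPow hS.1 _ _).differentiable (by simp) _)]
    have h₁ : a + ((ℓ + 1 : ℕ) : ℝ) - 1 = a + ℓ := by push_cast; ring
    have h₂ : a + (ℓ : ℝ) = a - 1 + ((ℓ + 1 : ℕ) : ℝ) := by push_cast; ring
    have h₃ (T : Vc n → Vc n → ℝ) : _root_.genHamPow n (a - 1) (ℓ + 1 + 1) T
        = _root_.genHam n (a + ℓ) (_root_.genHamPow n (a - 1) (ℓ + 1) T) := by
      rw [h₂, _root_.genHamPow]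
    rw [h₁, h₃, ← _root_.genHamPow]
    push_cast
    ring

/-- On `R^k_δ` and for `ℓ ≥ 1`: `i_α ∘ X^ℓ = X^ℓ ∘ i_α + r(ℓ,k) X^{ℓ−1}`, where
`r(ℓ,k) = −(ℓ/2)(2(n+1)δ + 2k + ℓ − 1)`. -/
theorem stmt8 (n : ℕ) (hn : 1 ≤ n) (k : ℕ) (δ : ℝ) (ℓ : ℕ) (hℓ : 1 ≤ ℓ)
    (S : Vc n → Vc n → ℝ) (hS : InR n k S) (x ξ : Vc n) :
    iAlpha n (genHamPow n (2*((n : ℝ)+1)*δ + k) ℓ S) x ξ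
      = genHamPow n (2*((n : ℝ)+1)*δ + k - 1) ℓ (iAlpha n S) x ξ
        + (-((ℓ : ℝ)/2) * (2*((n : ℝ)+1)*δ + 2*(k : ℝ) + (ℓ : ℝ) - 1))
            * genHamPow n (2*((n : ℝ)+1)*δ + k) (ℓ - 1) S x ξ := by
  obtain ⟨m, rfl⟩ := Nat.exists_eq_add_of_le' hℓ
  rw [hS.iAlpha_genHamPow_succ, Nat.add_sub_cancel]
  push_cast
  ring
end
end
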